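/- TeamLTL^l(⊽) translates into strict TeamLTL(⊽): for every TeamLTL(⊽)-formula φ there exists a TeamLTL(⊽)-formula ψ such that for every multiteam T: T ⊨ ψ under strict asynchronous team semantics if and only if support(T) ⊨ˡ φ under lax team semantics. -/

import Mathlib

namespace TeamLTL

/-- A trace over atomic propositions `AP` is an infinite sequence of sets of propositions. -/
abbrev Trace (AP : Type) := ℕ → Set AP

/-- `t[i,∞]`, the suffix of a trace. -/
def Trace.suffix {AP : Type} (t : Trace AP) (i : ℕ) : Trace AP := fun j => t (i + j)

/-- A team is a set of traces. -/
abbrev Team (AP : Type) := Set (Trace AP)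

/-- `T[f,∞] = { t[s,∞] : t ∈ T, s ∈ f t }` for `f : T → P(ℕ)⁺`. -/
def Team.update {AP : Type} (T : Team AP) (f : Trace AP → Set ℕ) : Team AP :=
  { s | ∃ t ∈ T, ∃ i ∈ f t, s = Trace.suffix t i }

/-- `f` maps every trace of `T` to a nonempty set of naturals (i.e. `f : T → P(ℕ)⁺`). -/
def properOn {AP : Type} (T : Team AP) (f : Trace AP → Set ℕ) : Prop :=
  ∀ t ∈ T, (f t).Nonempty

/-- `f' < f` on the team `T'`: for all `t ∈ T'`, `min (f' t) ≤ min (f t)` and whenever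
`f t` has a maximum, `f' t` has a maximum which is strictly smaller. -/
def funLT {AP : Type} (T' : Team AP) (f' f : Trace AP → Set ℕ) : Prop :=
  ∀ t ∈ T', sInf (f' t) ≤ sInf (f t) ∧
    ∀ m, IsGreatest (f t) m → ∃ m', IsGreatest (f' t) m' ∧ m' < m

/-- Formulae of TeamLTL, together with the Boolean disjunction `bor` (⊽) and the
Boolean negation `bneg` (∼).  Plain TeamLTL-formulae (= LTL-formulae in negation
normal form) are those satisfying `isLTL` below. -/
inductive Formula (AP : Type) : Type
  | atom  : AP → Formula AP
  | natom : AP → Formula AP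
  | conj  : Formula AP → Formula AP → Formula AP
  | disj  : Formula AP → Formula AP → Formula AP
  | next  : Formula AP → Formula AP
  | glob  : Formula AP → Formula AP
  | untl  : Formula AP → Formula AP → Formula AP
  | bor   : Formula AP → Formula AP → Formula AP
  | bneg  : Formula AP → Formula AP

/-- Lax team semantics `T ⊨ˡ φ`. -/
def laxSat {AP : Type} : Formula AP → Team AP → Prop
  | .atom p, T => ∀ t ∈ T, p ∈ t 0
  | .natom p, T => ∀ t ∈ T, p ∉ t 0
  | .conj φ ψ, T => laxSat φ T ∧ laxSat ψ T
  | .disj φ ψ, T => ∃ T₁ T₂ : Team AP, T = T₁ ∪ T₂ ∧ laxSat φ T₁ ∧ laxSat ψ T₂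
  | .next φ, T => laxSat φ (Team.update T (fun _ => {1}))
  | .glob φ, T => ∀ f, properOn T f → laxSat φ (Team.update T f)
  | .untl φ ψ, T => ∃ f, properOn T f ∧ laxSat ψ (Team.update T f) ∧
      ({t ∈ T | f t ≠ ({0} : Set ℕ)} = ∅ ∨
        ∀ f', properOn {t ∈ T | f t ≠ ({0} : Set ℕ)} f' →
          funLT {t ∈ T | f t ≠ ({0} : Set ℕ)} f' f →
          laxSat φ (Team.update {t ∈ T | f t ≠ ({0} : Set ℕ)} f'))
  | .bor φ ψ, T => laxSat φ T ∨ laxSat ψ T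
  | .bneg φ, T => ¬ laxSat φ T

/-- Classical LTL semantics on a single trace. -/
def traceSat {AP : Type} : Formula AP → Trace AP → Prop
  | .atom p, t => p ∈ t 0
  | .natom p, t => p ∉ t 0
  | .conj φ ψ, t => traceSat φ t ∧ traceSat ψ t
  | .disj φ ψ, t => traceSat φ t ∨ traceSat ψ t
  | .next φ, t => traceSat φ (Trace.suffix t 1)
  | .glob φ, t => ∀ i, traceSat φ (Trace.suffix t i)
  | .untl φ ψ, t => ∃ i, traceSat ψ (Trace.suffix t i) ∧ ∀ j < i, traceSat φ (Trace.suffix t j)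
  | .bor φ ψ, t => traceSat φ t ∨ traceSat ψ t
  | .bneg φ, t => ¬ traceSat φ t

/-- `φ` is a plain LTL-formula (no ⊽ and no ∼). -/
def Formula.isLTL {AP : Type} : Formula AP → Prop
  | .atom _ => True
  | .natom _ => True
  | .conj φ ψ => φ.isLTL ∧ ψ.isLTL
  | .disj φ ψ => φ.isLTL ∧ ψ.isLTL
  | .next φ => φ.isLTL
  | .glob φ => φ.isLTL
  | .untl φ ψ => φ.isLTL ∧ ψ.isLTL
  | .bor _ _ => False
  | .bneg _ => False

/-- `φ` is a TeamLTL(⊽)-formula (no Boolean negation ∼). -/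
def Formula.noBneg {AP : Type} : Formula AP → Prop
  | .atom _ => True
  | .natom _ => True
  | .conj φ ψ => φ.noBneg ∧ ψ.noBneg
  | .disj φ ψ => φ.noBneg ∧ ψ.noBneg
  | .next φ => φ.noBneg
  | .glob φ => φ.noBneg
  | .untl φ ψ => φ.noBneg ∧ ψ.noBneg
  | .bor φ ψ => φ.noBneg ∧ ψ.noBneg
  | .bneg _ => False

/-- `φ` is a TeamLTL(∼)-formula (no Boolean disjunction ⊽). -/
def Formula.noBor {AP : Type} : Formula AP → Prop
  | .atom _ => True
  | .natom _ => True
  | .conj φ ψ => φ.noBor ∧ ψ.noBor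
  | .disj φ ψ => φ.noBor ∧ ψ.noBor
  | .next φ => φ.noBor
  | .glob φ => φ.noBor
  | .untl φ ψ => φ.noBor ∧ ψ.noBor
  | .bor _ _ => False
  | .bneg φ => φ.noBor

/-- Left-flatness: in every subformula `G ψ` and `ψ U θ`, `ψ` is an LTL-formula;
moreover `φ` is a TeamLTL(⊽)-formula (no ∼). -/
def Formula.leftFlat {AP : Type} : Formula AP → Prop
  | .atom _ => True
  | .natom _ => True
  | .conj φ ψ => φ.leftFlat ∧ ψ.leftFlat
  | .disj φ ψ => φ.leftFlat ∧ ψ.leftFlat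
  | .next φ => φ.leftFlat
  | .glob φ => φ.isLTL
  | .untl φ ψ => φ.isLTL ∧ ψ.leftFlat
  | .bor φ ψ => φ.leftFlat ∧ ψ.leftFlat
  | .bneg _ => False

/-- Left-downward closure: in every subformula `G ψ` and `ψ U θ`, `ψ` is a
TeamLTL(⊽)-formula (contains no ∼). -/
def Formula.leftDC {AP : Type} : Formula AP → Prop
  | .atom _ => True
  | .natom _ => True
  | .conj φ ψ => φ.leftDC ∧ ψ.leftDC
  | .disj φ ψ => φ.leftDC ∧ ψ.leftDC
  | .next φ => φ.leftDC
  | .glob φ => φ.noBneg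
  | .untl φ ψ => φ.noBneg ∧ ψ.leftDC
  | .bor φ ψ => φ.leftDC ∧ ψ.leftDC
  | .bneg φ => φ.leftDC

/-- Length (size) of a formula. -/
def Formula.size {AP : Type} : Formula AP → ℕ
  | .atom _ => 1
  | .natom _ => 1
  | .conj φ ψ => φ.size + ψ.size + 1
  | .disj φ ψ => φ.size + ψ.size + 1
  | .next φ => φ.size + 1
  | .glob φ => φ.size + 1
  | .untl φ ψ => φ.size + ψ.size + 1
  | .bor φ ψ => φ.size + ψ.size + 1
  | .bneg φ => φ.size + 1

/-- Number of occurrences of the Boolean disjunction ⊽ in a formula. -/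
def Formula.borCount {AP : Type} : Formula AP → ℕ
  | .atom _ => 0
  | .natom _ => 0
  | .conj φ ψ => φ.borCount + ψ.borCount
  | .disj φ ψ => φ.borCount + ψ.borCount
  | .next φ => φ.borCount
  | .glob φ => φ.borCount
  | .untl φ ψ => φ.borCount + ψ.borCount
  | .bor φ ψ => φ.borCount + ψ.borCount + 1
  | .bneg φ => φ.borCount

/-- Boolean disjunction `⊽` of a nonempty list of formulae (head plus tail). -/
def disjOf {AP : Type} : Formula AP → List (Formula AP) → Formula AP
  | a, [] => a
  | a, b :: l => .bor a (disjOf b l)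

/-- Conjunction `a ∧ ⋀ l` of a formula with a (possibly empty) list of formulae. -/
def conjAnd {AP : Type} (a : Formula AP) : List (Formula AP) → Formula AP
  | [] => a
  | b :: l => .conj (conjAnd a l) b

/-- Some atomic proposition occurring in a formula. -/
def Formula.someAtom {AP : Type} : Formula AP → AP
  | .atom p => p
  | .natom p => p
  | .conj φ _ => φ.someAtom
  | .disj φ _ => φ.someAtom
  | .next φ => φ.someAtom
  | .glob φ => φ.someAtom
  | .untl φ _ => φ.someAtom
  | .bor φ _ => φ.someAtom
  | .bneg φ => φ.someAtom

/-- The dual `φ^d`: the negation normal form of `¬φ` (for LTL-formulae `φ`).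
`¬Gφ` is rewritten as `⊤ U ¬φ` and `¬(φUψ)` as `(¬ψ U (¬φ ∧ ¬ψ)) ∨ G¬ψ`. -/
def Formula.dual {AP : Type} : Formula AP → Formula AP
  | .atom p => .natom p
  | .natom p => .atom p
  | .conj φ ψ => .disj φ.dual ψ.dual
  | .disj φ ψ => .conj φ.dual ψ.dual
  | .next φ => .next φ.dual
  | .glob φ => .untl (.disj (.atom φ.someAtom) (.natom φ.someAtom)) φ.dual
  | .untl φ ψ => .disj (.untl ψ.dual (.conj φ.dual ψ.dual)) (.glob ψ.dual)
  | .bor φ ψ => .conj φ.dual ψ.dual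
  | .bneg φ => φ

/-- `∃β`, an abbreviation for `∼β^d`: it holds in a team `T` iff some trace of `T`
satisfies `β` classically. -/
def Formula.exi {AP : Type} (β : Formula AP) : Formula AP := .bneg β.dual

end TeamLTL
namespace TeamLTL

/-- A multiteam is a set of index–trace pairs. -/
abbrev MultiTeam (ι : Type) (AP : Type) := Set (ι × Trace AP)

/-- `T[f,∞] = { (i, t[f(i,t),∞]) : (i,t) ∈ T }` for `f : T → ℕ`. -/
def MultiTeam.update {ι AP : Type} (T : MultiTeam ι AP) (f : ι × Trace AP → ℕ) :
    MultiTeam ι AP :=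
  { x | ∃ y ∈ T, x = (y.1, Trace.suffix y.2 (f y)) }

/-- The support of a multiteam: the set of traces occurring in it. -/
def MultiTeam.support {ι AP : Type} (T : MultiTeam ι AP) : Team AP :=
  { t | ∃ i, (i, t) ∈ T }

/-- Strict asynchronous team semantics `T ⊨ φ` on multiteams. -/
def strictSat {ι AP : Type} : Formula AP → MultiTeam ι AP → Prop
  | .atom p, T => ∀ x ∈ T, p ∈ x.2 0
  | .natom p, T => ∀ x ∈ T, p ∉ x.2 0
  | .conj φ ψ, T => strictSat φ T ∧ strictSat ψ T
  | .disj φ ψ, T => ∃ T₁ T₂ : MultiTeam ι AP,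
      T = T₁ ∪ T₂ ∧ T₁ ∩ T₂ = ∅ ∧ strictSat φ T₁ ∧ strictSat ψ T₂
  | .next φ, T => strictSat φ (MultiTeam.update T (fun _ => 1))
  | .glob φ, T => ∀ f, strictSat φ (MultiTeam.update T f)
  | .untl φ ψ, T => ∃ f, strictSat ψ (MultiTeam.update T f) ∧
      ∀ f', (∀ x ∈ {x ∈ T | f x ≠ 0}, f' x < f x) →
        strictSat φ (MultiTeam.update {x ∈ T | f x ≠ 0} f')
  | .bor φ ψ, T => strictSat φ T ∨ strictSat ψ T
  | .bneg φ, T => ¬ strictSat φ T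

end TeamLTL

namespace TeamLTL

/-- Plain LTL-formulae contain no `∼`. -/
theorem Formula.isLTL.noBneg {AP : Type} {α : Formula AP} (h : α.isLTL) : α.noBneg := by
  induction α with
  | atom | natom => trivial
  | conj _ _ ih₁ ih₂ | disj _ _ ih₁ ih₂ | untl _ _ ih₁ ih₂ => exact ⟨ih₁ h.1, ih₂ h.2⟩
  | next _ ih | glob _ ih => exact ih h
  | bor | bneg => exact h.elim

theorem noBneg_disjOf {AP : Type} (a : Formula AP) (l : List (Formula AP))
    (h : ∀ α ∈ a :: l, α.noBneg) : (disjOf a l).noBneg := by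
  induction l generalizing a with
  | nil => exact h a (by simp)
  | cons b l ih =>
    exact ⟨h a (by simp), ih b fun α hα => h α (List.mem_cons_of_mem _ hα)⟩

theorem strictSat_disjOf {ι AP : Type} (a : Formula AP) (l : List (Formula AP))
    (T : MultiTeam ι AP) : strictSat (disjOf a l) T ↔ ∃ α ∈ a :: l, strictSat α T := by
  induction l generalizing a with
  | nil => simp [disjOf]
  | cons b l ih => rw [disjOf, strictSat, ih, List.exists_mem_cons_iff _ a]

/-- Plain LTL-formulae are flat under strict asynchronous team semantics. -/
theorem strictSat_iff_forall_traceSat {ι AP : Type} {α : Formula AP} (h : α.isLTL)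
    (T : MultiTeam ι AP) : strictSat α T ↔ ∀ x ∈ T, traceSat α x.2 := by
  induction α generalizing T with
  | atom | natom => rfl
  | conj α β ihα ihβ =>
    simp only [strictSat, traceSat, ihα h.1, ihβ h.2]
    exact ⟨fun H x hx => ⟨H.1 x hx, H.2 x hx⟩, fun H => ⟨fun x hx => (H x hx).1,
      fun x hx => (H x hx).2⟩⟩
  | disj α β ihα ihβ =>
    simp only [strictSat, traceSat, ihα h.1, ihβ h.2]
    constructor
    · rintro ⟨T₁, T₂, rfl, -, h₁, h₂⟩ x (hx | hx)
      · exact Or.inl (h₁ x hx)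
      · exact Or.inr (h₂ x hx)
    · intro H
      refine ⟨{x ∈ T | traceSat α x.2}, {x ∈ T | ¬ traceSat α x.2}, ?_, ?_, fun x hx => hx.2,
        fun x hx => (H x hx.1).resolve_left hx.2⟩
      · ext x
        simp only [Set.mem_union, Set.mem_ofPred_eq]
        tauto
      · ext x
        simp only [Set.mem_inter_iff, Set.mem_ofPred_eq, Set.mem_empty_iff_false]
        tauto
  | next α ih =>
    simp only [strictSat, traceSat, ih h]
    constructor
    · exact fun H x hx => H _ ⟨x, hx, rfl⟩
    · rintro H _ ⟨x, hx, rfl⟩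
      exact H x hx
  | glob α ih =>
    simp only [strictSat, traceSat, ih h]
    constructor
    · exact fun H x hx i => H (fun _ => i) _ ⟨x, hx, rfl⟩
    · rintro H f _ ⟨x, hx, rfl⟩
      exact H x hx _
  | untl α β ihα ihβ =>
    simp only [strictSat, traceSat, ihα h.1, ihβ h.2]
    classical
    constructor
    · rintro ⟨f, hβ, hα⟩ x hx
      refine ⟨f x, hβ _ ⟨x, hx, rfl⟩, fun j hj => ?_⟩
      have key := hα (fun y => if y = x then j else 0) (fun y hy => ?_) _
        ⟨x, ⟨hx, Nat.ne_zero_of_lt hj⟩, rfl⟩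
      · simpa using key
      · split_ifs with hyx
        · rwa [hyx]
        · exact Nat.pos_of_ne_zero hy.2
    · intro H
      choose! f hβ hα using H
      refine ⟨f, ?_, ?_⟩
      · rintro _ ⟨x, hx, rfl⟩
        exact hβ x hx
      · rintro f' hf' _ ⟨x, hx, rfl⟩
        exact hα x hx.1 _ (hf' x hx)
  | bor | bneg => exact h.elim

/-- Under lax semantics, `G α` for a flat `α` constrains exactly all suffixes. -/
theorem forall_update_exists_iff {AP : Type} (L : List (Formula AP)) (T : Team AP) :
    (∀ f, properOn T f → ∃ α ∈ L, ∀ s ∈ Team.update T f, traceSat α s) ↔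
      ∃ α ∈ L, ∀ t ∈ T, ∀ i, traceSat α (Trace.suffix t i) := by
  constructor
  · intro H
    obtain ⟨α, hα, hs⟩ := H (fun _ => Set.univ) fun _ _ => Set.univ_nonempty
    exact ⟨α, hα, fun t ht i => hs _ ⟨t, ht, i, trivial, rfl⟩⟩
  · rintro ⟨α, hα, hs⟩ f -
    refine ⟨α, hα, ?_⟩
    rintro _ ⟨t, ht, i, -, rfl⟩
    exact hs t ht i

/-- The set of points strictly below some element of `s` is the largest choice below `s`. -/
theorem strictLower_lt {s : Set ℕ} (hs : s.Nonempty) (h0 : s ≠ {0}) :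
    {j | ∃ k ∈ s, j < k}.Nonempty ∧ sInf {j | ∃ k ∈ s, j < k} ≤ sInf s ∧
      ∀ m, IsGreatest s m → ∃ m', IsGreatest {j | ∃ k ∈ s, j < k} m' ∧ m' < m := by
  obtain ⟨k, hk, hk0⟩ : ∃ k ∈ s, 0 < k := by
    by_contra! hc
    exact h0 (hs.subset_singleton_iff.mp fun k hk => Nat.le_zero.mp (hc k hk))
  have hmem : 0 ∈ {j | ∃ k ∈ s, j < k} := ⟨k, hk, hk0⟩
  refine ⟨⟨0, hmem⟩, (Nat.sInf_le hmem).trans (Nat.zero_le _), fun m hm => ?_⟩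
  have hm0 : 0 < m := hk0.trans_le (hm.2 hk)
  refine ⟨m - 1, ⟨⟨m, hm.1, by omega⟩, ?_⟩, by omega⟩
  rintro j ⟨l, hl, hjl⟩
  have := hm.2 hl
  omega

/-- Lax until between Boolean disjunctions of flat formulae splits into finitely many
classical untils. -/
theorem lax_until_iff {AP : Type} (L M : List (Formula AP)) (hL : L ≠ []) (T : Team AP) :
    (∃ f, properOn T f ∧ (∃ β ∈ M, ∀ s ∈ Team.update T f, traceSat β s) ∧
      ({t ∈ T | f t ≠ ({0} : Set ℕ)} = ∅ ∨
        ∀ f', properOn {t ∈ T | f t ≠ ({0} : Set ℕ)} f' →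
          funLT {t ∈ T | f t ≠ ({0} : Set ℕ)} f' f →
          ∃ α ∈ L, ∀ s ∈ Team.update {t ∈ T | f t ≠ ({0} : Set ℕ)} f', traceSat α s)) ↔
      ∃ α ∈ L, ∃ β ∈ M, ∀ t ∈ T, traceSat (.untl α β) t := by
  constructor
  · rintro ⟨f, hf, ⟨β, hβ, hsβ⟩, H⟩
    obtain ⟨α, hα, hsα⟩ : ∃ α ∈ L, ∀ t ∈ T, f t ≠ {0} → ∀ k ∈ f t, ∀ j < k,
        traceSat α (Trace.suffix t j) := by
      rcases H with H | H
      · obtain ⟨α, hα⟩ := List.exists_mem_of_ne_nil L hL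
        refine ⟨α, hα, fun t ht h0 => ?_⟩
        exact (Set.eq_empty_iff_forall_notMem.mp H t ⟨ht, h0⟩).elim
      · obtain ⟨α, hα, hsα⟩ := H (fun t => {j | ∃ k ∈ f t, j < k})
          (fun t ht => (strictLower_lt (hf t ht.1) ht.2).1)
          (fun t ht => (strictLower_lt (hf t ht.1) ht.2).2)
        exact ⟨α, hα, fun t ht h0 k hk j hj => hsα _ ⟨t, ⟨ht, h0⟩, j, ⟨k, hk, hj⟩, rfl⟩⟩
    refine ⟨α, hα, β, hβ, fun t ht => ?_⟩
    obtain ⟨k, hk⟩ := hf t ht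
    refine ⟨k, hsβ _ ⟨t, ht, k, hk, rfl⟩, fun j hj => ?_⟩
    refine hsα t ht (fun h0 => ?_) k hk j hj
    rw [h0, Set.mem_singleton_iff] at hk
    omega
  · rintro ⟨α, hα, β, hβ, H⟩
    simp only [traceSat] at H
    choose! g hgβ hgα using H
    refine ⟨fun t => {g t}, fun _ _ => Set.singleton_nonempty _, ⟨β, hβ, ?_⟩,
      Or.inr fun f' _ hlt => ⟨α, hα, ?_⟩⟩
    · rintro _ ⟨t, ht, i, rfl, rfl⟩
      exact hgβ t ht
    · rintro _ ⟨t, ht, i, hi, rfl⟩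
      obtain ⟨m, hm, hmg⟩ := (hlt t ht).2 (g t) isGreatest_singleton
      exact hgα t ht.1 i ((hm.2 hi).trans_lt hmg)

/-- Under lax semantics every TeamLTL(⊽)-formula is equivalent to a finite nonempty Boolean
disjunction of flat LTL-formulae. -/
theorem exists_lax_normal_form {AP : Type} {φ : Formula AP} (hφ : φ.noBneg) :
    ∃ L : List (Formula AP), L ≠ [] ∧ (∀ α ∈ L, α.isLTL) ∧
      ∀ T, laxSat φ T ↔ ∃ α ∈ L, ∀ t ∈ T, traceSat α t := by
  induction φ with
  | atom p => exact ⟨[.atom p], by simp, by simp [Formula.isLTL], by simp [laxSat, traceSat]⟩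
  | natom p => exact ⟨[.natom p], by simp, by simp [Formula.isLTL], by simp [laxSat, traceSat]⟩
  | conj φ ψ ihφ ihψ =>
    obtain ⟨L, hL, hL', hφL⟩ := ihφ hφ.1
    obtain ⟨M, hM, hM', hψM⟩ := ihψ hφ.2
    refine ⟨L.flatMap fun α => M.map (.conj α), ?_, ?_, fun T => ?_⟩
    · simpa [List.eq_nil_iff_forall_not_mem] using
        And.intro (List.exists_mem_of_ne_nil L hL) (List.exists_mem_of_ne_nil M hM)
    · simp only [List.mem_flatMap, List.mem_map]
      rintro _ ⟨α, hα, β, hβ, rfl⟩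
      exact ⟨hL' α hα, hM' β hβ⟩
    · simp only [laxSat, hφL, hψM, List.mem_flatMap, List.mem_map]
      constructor
      · rintro ⟨⟨α, hα, h₁⟩, β, hβ, h₂⟩
        exact ⟨_, ⟨α, hα, β, hβ, rfl⟩, fun t ht => ⟨h₁ t ht, h₂ t ht⟩⟩
      · rintro ⟨_, ⟨α, hα, β, hβ, rfl⟩, h⟩
        exact ⟨⟨α, hα, fun t ht => (h t ht).1⟩, β, hβ, fun t ht => (h t ht).2⟩
  | disj φ ψ ihφ ihψ =>
    obtain ⟨L, hL, hL', hφL⟩ := ihφ hφ.1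
    obtain ⟨M, hM, hM', hψM⟩ := ihψ hφ.2
    refine ⟨L.flatMap fun α => M.map (.disj α), ?_, ?_, fun T => ?_⟩
    · simpa [List.eq_nil_iff_forall_not_mem] using
        And.intro (List.exists_mem_of_ne_nil L hL) (List.exists_mem_of_ne_nil M hM)
    · simp only [List.mem_flatMap, List.mem_map]
      rintro _ ⟨α, hα, β, hβ, rfl⟩
      exact ⟨hL' α hα, hM' β hβ⟩
    · simp only [laxSat, hφL, hψM, List.mem_flatMap, List.mem_map]
      constructor
      · rintro ⟨T₁, T₂, rfl, ⟨α, hα, h₁⟩, β, hβ, h₂⟩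
        exact ⟨_, ⟨α, hα, β, hβ, rfl⟩, fun t ht => ht.imp (h₁ t) (h₂ t)⟩
      · rintro ⟨_, ⟨α, hα, β, hβ, rfl⟩, h⟩
        refine ⟨{t ∈ T | traceSat α t}, {t ∈ T | traceSat β t}, ?_,
          ⟨α, hα, fun t ht => ht.2⟩, β, hβ, fun t ht => ht.2⟩
        ext t
        exact ⟨fun ht => (h t ht).imp (⟨ht, ·⟩) (⟨ht, ·⟩), fun ht => ht.elim (·.1) (·.1)⟩
  | next φ ih =>
    obtain ⟨L, hL, hL', hφL⟩ := ih hφ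
    refine ⟨L.map .next, by simpa using hL, by simpa [Formula.isLTL] using hL', fun T => ?_⟩
    simp only [laxSat, hφL, List.mem_map, exists_exists_and_eq_and, traceSat]
    refine exists_congr fun α => and_congr_right fun _ =>
      ⟨fun H t ht => H _ ⟨t, ht, 1, rfl, rfl⟩, ?_⟩
    rintro H _ ⟨t, ht, _, rfl, rfl⟩
    exact H t ht
  | glob φ ih =>
    obtain ⟨L, hL, hL', hφL⟩ := ih hφ
    refine ⟨L.map .glob, by simpa using hL, by simpa [Formula.isLTL] using hL', fun T => ?_⟩
    simp only [laxSat, hφL, forall_update_exists_iff, List.mem_map,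
      exists_exists_and_eq_and, traceSat]
  | untl φ ψ ihφ ihψ =>
    obtain ⟨L, hL, hL', hφL⟩ := ihφ hφ.1
    obtain ⟨M, hM, hM', hψM⟩ := ihψ hφ.2
    refine ⟨L.flatMap fun α => M.map (.untl α), ?_, ?_, fun T => ?_⟩
    · simpa [List.eq_nil_iff_forall_not_mem] using
        And.intro (List.exists_mem_of_ne_nil L hL) (List.exists_mem_of_ne_nil M hM)
    · simp only [List.mem_flatMap, List.mem_map]
      rintro _ ⟨α, hα, β, hβ, rfl⟩
      exact ⟨hL' α hα, hM' β hβ⟩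
    · simp only [laxSat, hφL, hψM, lax_until_iff L M hL, List.mem_flatMap, List.mem_map]
      constructor
      · rintro ⟨α, hα, β, hβ, h⟩
        exact ⟨_, ⟨α, hα, β, hβ, rfl⟩, h⟩
      · rintro ⟨_, ⟨α, hα, β, hβ, rfl⟩, h⟩
        exact ⟨α, hα, β, hβ, h⟩
  | bor φ ψ ihφ ihψ =>
    obtain ⟨L, hL, hL', hφL⟩ := ihφ hφ.1
    obtain ⟨M, -, hM', hψM⟩ := ihψ hφ.2
    refine ⟨L ++ M, by simp [hL], ?_, fun T => ?_⟩
    · exact fun α hα => (List.mem_append.mp hα).elim (hL' α) (hM' α)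
    · simp only [laxSat, hφL, hψM, List.mem_append, or_and_right, exists_or]
  | bneg => exact hφ.elim

/-- TeamLTL^l(⊽) translates into strict TeamLTL(⊽): for every TeamLTL(⊽)-formula `φ`
there is a TeamLTL(⊽)-formula `ψ` such that for every multiteam `T`, `T ⊨ ψ`
strictly iff `support(T) ⊨ˡ φ`. -/
theorem lax_bor_translates_to_strict_bor {AP : Type} (φ : Formula AP)
    (hφ : φ.noBneg) :
    ∃ ψ : Formula AP, ψ.noBneg ∧
      ∀ (ι : Type) (T : MultiTeam ι AP),
        strictSat ψ T ↔ laxSat φ (MultiTeam.support T) := by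
  obtain ⟨L, hL, hLTL, hφL⟩ := exists_lax_normal_form hφ
  obtain ⟨a, l, rfl⟩ := List.exists_cons_of_ne_nil hL
  refine ⟨disjOf a l, noBneg_disjOf a l fun α hα => (hLTL α hα).noBneg, fun ι T => ?_⟩
  rw [strictSat_disjOf, hφL]
  refine exists_congr fun α => and_congr_right fun hα => ?_
  rw [strictSat_iff_forall_traceSat (hLTL α hα)]
  exact ⟨fun H t ⟨i, hi⟩ => H (i, t) hi, fun H x hx => H x.2 ⟨x.1, hx⟩⟩

end TeamLTL
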